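/- arXiv:2604.08408 — 2 statements merged into one kernel-verified Lean document; each statement's English description precedes it below -/
import Mathlib

section
/- For any a > 0 and ω ∈ ℝ, ∫_0^∞ sin(ωu)/sinh(au) du = (π/(2a))·tanh(πω/(2a)). -/
open MeasureTheory Set

lemma aux_int (b w : ℝ) (hb : 0 < b) :
    IntegrableOn (fun u : ℝ => Real.sin (w*u) * Real.exp (-b*u)) (Ioi 0) ∧
    ∫ u in Ioi (0:ℝ), Real.sin (w*u) * Real.exp (-b*u) = w / (b^2+w^2) := by
  have hre : (-(b:ℂ) + w * Complex.I).re < 0 := by simp [hb]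
  have h1 := integrableOn_exp_mul_complex_Ioi hre 0
  have h2 := integral_exp_mul_complex_Ioi hre 0
  have he : ∀ u : ℝ, (Complex.exp ((-(b:ℂ) + w * Complex.I) * u)).im
      = Real.sin (w*u) * Real.exp (-b*u) := by
    intro u
    rw [Complex.exp_im]
    simp [mul_comm]
  constructor
  · have := h1.im
    simpa [he] using! this
  · have h3 := integral_im h1
    have h4 : ∫ u in Ioi (0:ℝ), Real.sin (w*u) * Real.exp (-b*u)
        = (∫ u in Ioi (0:ℝ), Complex.exp ((-(b:ℂ) + w * Complex.I) * u)).im := by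
      rw [← RCLike.im_eq_complex_im, ← h3]
      simp [he]
    rw [h4, h2]
    simp [Complex.div_im, Complex.normSq]
    ring

lemma aux_bound (b w : ℝ) (hb : 0 < b) :
    ∫ u in Ioi (0:ℝ), ‖Real.sin (w*u) * Real.exp (-b*u)‖ ≤ |w| / b^2 := by
  have h := Real.integral_rpow_mul_exp_neg_mul_Ioi (a := 2) (r := b) (by norm_num) hb
  have h2 : ∫ u in Ioi (0:ℝ), |w| * (u ^ ((2:ℝ)-1) * Real.exp (-(b*u))) = |w| / b^2 := by
    rw [integral_const_mul, h]
    have : Real.Gamma 2 = 1 := Real.Gamma_two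
    rw [this]
    norm_num
    field_simp
  rw [← h2]
  apply setIntegral_mono_on (aux_int b w hb).1.norm
  · by_contra hc
    have hw : w ≠ 0 := by
      rintro rfl
      simp at hc
    have := integral_undef hc
    rw [h2] at this
    have h5 : 0 < |w| / b^2 := by positivity
    linarith
  · exact measurableSet_Ioi
  · intro u hu
    have hu' : (0:ℝ) < u := hu
    have e : u ^ ((2:ℝ)-1) = u := by norm_num
    rw [e, norm_mul, Real.norm_eq_abs, Real.norm_eq_abs, Real.abs_exp, ← mul_assoc]
    have h6 : |Real.sin (w*u)| ≤ |w| * u := by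
      have := Real.abs_sin_le_abs (x := w*u)
      rwa [abs_mul, abs_of_pos hu'] at this
    rw [neg_mul]
    gcongr

lemma aux_geom (a u : ℝ) (h : 0 < a * u) :
    HasSum (fun n : ℕ => 2 * Real.exp (-((2*n+1)*a)*u)) (1 / Real.sinh (a*u)) := by
  have hq : Real.exp (-(2*(a*u))) < 1 := by rw [Real.exp_lt_one_iff]; linarith
  have := (hasSum_geometric_of_lt_one (Real.exp_pos _).le hq).mul_left (2 * Real.exp (-(a*u)))
  convert! this using 1
  · ext n
    rw [← Real.exp_nat_mul, mul_assoc, ← Real.exp_add]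
    congr 2; ring
  · have hx : Real.exp (-(2*(a*u))) = Real.exp (-(a*u)) ^ 2 := by
      rw [← Real.exp_nat_mul]; congr 1; push_cast; ring
    have h7 : Real.exp (a*u) = (Real.exp (-(a*u)))⁻¹ := by rw [Real.exp_neg, inv_inv]
    rw [hx] at hq ⊢
    rw [Real.sinh_eq, h7]
    have hp := Real.exp_pos (-(a*u))
    set q := Real.exp (-(a*u))
    have : 1 - q^2 ≠ 0 := by linarith
    have h8 : q⁻¹ - q = (1-q^2)/q := by field_simp
    rw [h8]
    field_simp

lemma aux_coth (t : ℝ) (ht : t ≠ 0) :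
    HasSum (fun n : ℕ => 2 * t / (t^2 + ((n:ℝ)+1)^2))
      (Real.pi * (Real.cosh (Real.pi*t) / Real.sinh (Real.pi*t)) - 1/t) := by
  have hz : (t * Complex.I : ℂ) ∈ Complex.integerComplement := by
    rintro ⟨n, hn⟩
    have := congrArg Complex.im hn
    simp at this
    exact ht this.symm
  have hs := (summable_cotTerm hz).hasSum
  have := cot_series_rep' hz
  have e : ∀ n, cotTerm (t * Complex.I) n = 1 / (t * Complex.I - (n + 1)) + 1 / (t * Complex.I + (n + 1)) := fun n => rfl
  simp_rw [← e] at this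
  rw [← this] at hs
  have hs2 := hs.mul_left Complex.I
  rw [← Complex.hasSum_ofReal] 
  convert! hs2 using 1
  · ext n
    rw [cotTerm_identity hz]
    have h1 : (t * Complex.I : ℂ)^2 = -(t:ℂ)^2 := by rw [mul_pow, Complex.I_sq]; ring
    have h2 : ((t:ℂ)^2 + ((n:ℂ)+1)^2) ≠ 0 := by
      have : (0:ℝ) < t^2 + ((n:ℝ)+1)^2 := by positivity
      exact_mod_cast this.ne'
    have h3 : (t * Complex.I + ((n:ℂ) + 1)) * (t * Complex.I - ((n:ℂ) + 1)) = -((t:ℂ)^2 + ((n:ℂ)+1)^2) := by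
      linear_combination h1
    push_cast
    rw [h3]
    field_simp
    rw [Complex.I_sq]; ring
  · have hsh : Complex.sinh (Real.pi * t) ≠ 0 := by
      have : Real.sinh (Real.pi * t) ≠ 0 := by
        rw [Ne, Real.sinh_eq_zero]; positivity
      exact_mod_cast this
    have ht' : (t:ℂ) ≠ 0 := by exact_mod_cast ht
    rw [Complex.cot_eq_cos_div_sin, ← mul_assoc, Complex.cos_mul_I, Complex.sin_mul_I]
    push_cast
    field_simp
    
lemma aux_tanh (t : ℝ) (ht : t ≠ 0) :
    HasSum (fun n : ℕ => 2 * t / (t^2 + (2*(n:ℝ)+1)^2))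
      (Real.pi / 2 * Real.tanh (Real.pi*t/2)) := by
  have h1 := aux_coth t ht
  have h2 := (aux_coth (t/2) (by positivity)).mul_left (1/2)
  have hinj : Function.Injective (fun n : ℕ => 2 * n) := fun x y h => by simpa using h
  have h3 := (h1.summable.comp_injective hinj).hasSum
  set S := ∑' b, ((fun n : ℕ => 2 * t / (t^2 + ((n:ℝ)+1)^2)) ∘ fun n : ℕ => 2 * n) b with hS
  have h2' : HasSum (fun n : ℕ => 2 * t / (t^2 + (((2*n+1 : ℕ):ℝ)+1)^2))
      (1 / 2 * (Real.pi * (Real.cosh (Real.pi * (t / 2)) / Real.sinh (Real.pi * (t / 2))) - 1 / (t / 2))) := by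
    convert! h2 using 1
    ext n
    push_cast
    have : (t/2)^2 + ((n:ℝ)+1)^2 ≠ 0 := by positivity
    have : t^2 + (2*(n:ℝ)+1+1)^2 ≠ 0 := by positivity
    field_simp
    ring
  have h4 := h1.unique (HasSum.even_add_odd (f := fun n : ℕ => 2 * t / (t^2 + ((n:ℝ)+1)^2)) h3 h2')
  have h5 : S = Real.pi / 2 * Real.tanh (Real.pi*t/2) := by
    rw [← sub_eq_iff_eq_add] at h4
    have hx : Real.pi * t = 2 * (Real.pi * t / 2) := by ring
    have hy : Real.pi * (t/2) = Real.pi * t / 2 := by ring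
    rw [← h4, hy, hx, Real.tanh_eq_sinh_div_cosh, Real.cosh_two_mul, Real.sinh_two_mul]
    have hs : Real.sinh (Real.pi * t / 2) ≠ 0 := by
      rw [Ne, Real.sinh_eq_zero]; positivity
    have hc := (Real.cosh_pos (Real.pi * t / 2)).ne'
    have hx2 : 2 * (Real.pi * t / 2) / 2 = Real.pi * t / 2 := by ring
    rw [hx2]
    field_simp
    ring
  rw [← h5]
  convert! h3 using 1
  ext n
  simp

theorem integral_sin_div_sinh (a ω : ℝ) (ha : 0 < a) :
    ∫ u in Set.Ioi (0 : ℝ), Real.sin (ω * u) / Real.sinh (a * u)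
      = Real.pi / (2 * a) * Real.tanh (Real.pi * ω / (2 * a)) := by
  rcases eq_or_ne ω 0 with rfl | hω
  · simp
  have hb : ∀ n : ℕ, 0 < (2*(n:ℝ)+1)*a := fun n => by positivity
  have key := hasSum_integral_of_summable_integral_norm (μ := volume.restrict (Ioi (0:ℝ)))
    (F := fun (n : ℕ) (u : ℝ) => 2 * (Real.sin (ω*u) * Real.exp (-((2*(n:ℝ)+1)*a)*u)))
    (fun n => (aux_int _ ω (hb n)).1.const_mul 2) (by
      have hs : Summable (fun n : ℕ => 2 * (|ω| / a^2 * (1 / ((n:ℝ)+1)^2))) := by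
        have := (summable_nat_add_iff 1).2 (Real.summable_one_div_nat_pow.2 (by norm_num : 1 < 2))
        push_cast at this
        exact (this.mul_left _).mul_left _
      refine Summable.of_nonneg_of_le (fun n => integral_nonneg fun u => norm_nonneg _) (fun n => ?_) hs
      simp_rw [norm_mul (2:ℝ)]
      rw [integral_const_mul, Real.norm_eq_abs, abs_two]
      refine mul_le_mul_of_nonneg_left ((aux_bound _ ω (hb n)).trans ?_) (by norm_num)
      rw [mul_pow, div_mul_div_comm, mul_one, mul_comm (a^2)]
      gcongr
      have : (0:ℝ) ≤ n := n.cast_nonneg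
      linarith)
  have e1 : ∫ u in Set.Ioi (0 : ℝ), Real.sin (ω * u) / Real.sinh (a * u) =
      ∫ u in Ioi (0:ℝ), ∑' n : ℕ, 2 * (Real.sin (ω*u) * Real.exp (-((2*(n:ℝ)+1)*a)*u)) := by
    refine setIntegral_congr_fun measurableSet_Ioi fun u hu => ?_
    have := (aux_geom a u (mul_pos ha hu)).mul_left (Real.sin (ω*u))
    rw [div_eq_mul_one_div, ← this.tsum_eq]
    congr 1; ext n; ring
  rw [e1]
  refine key.unique ?_
  have h := (aux_tanh (ω/a) (by positivity)).mul_left (1/a)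
  convert! h using 1
  · ext n
    rw [integral_const_mul, (aux_int _ ω (hb n)).2]
    have h1 : ((2*(n:ℝ)+1)*a)^2 + ω^2 ≠ 0 := by positivity
    have h2 : (ω/a)^2 + (2*(n:ℝ)+1)^2 ≠ 0 := by positivity
    field_simp
    ring
  · rw [show Real.pi * (ω/a)/2 = Real.pi * ω / (2*a) by field_simp]
    field_simp
end

section
/- Let σ, β > 0 and define b₁(t) = (σ/(πβ))·e^{β²σ²/8}·( sech(2π·/β) * ( sin(−βσ²·)·e^{−2σ²·²} ) )(t), the convolution of sech(2πt/β) with sin(−βσ²t)·e^{−2σ²t²} evaluated at t. Then the Fourier transform b̂₁(ω) = ∫_{−∞}^{∞} b₁(t)·e^{−iωt} dt equals (i/(2√(2π)))·e^{−ω²/(8σ²)}·tanh(βω/4). -/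
open MeasureTheory in
lemma sech_pointwise (η y : ℝ) :
    |Real.sigmoid y * (1 - Real.sigmoid y)| •
      (((Real.sigmoid y : ℝ) : ℂ) ^ ((1 / 2 + Complex.I * η : ℂ) - 1) *
        (1 - ((Real.sigmoid y : ℝ) : ℂ)) ^ ((1 / 2 - Complex.I * η : ℂ) - 1))
      = (1 / 2 : ℂ) * (((1 / Real.cosh (y / 2) : ℝ) : ℂ) * Complex.exp (Complex.I * η * y)) := by
  have ha := Real.sigmoid_pos y
  obtain ⟨l, hl⟩ : ∃ l, Real.sigmoid y = Real.exp l := ⟨_, (Real.exp_log ha).symm⟩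
  have hb : 1 - Real.sigmoid y = Real.exp (l - y) := by
    rw [← Real.sigmoid_neg, ← Real.sigmoid_mul_rexp_neg, hl, ← Real.exp_add]; ring_nf
  have hbc : (1 - ((Real.sigmoid y : ℝ) : ℂ)) = ((Real.exp (l - y) : ℝ) : ℂ) := by
    rw [← hb]; push_cast; rfl
  have hp : ∀ (r : ℝ) (w : ℂ), ((Real.exp r : ℝ) : ℂ) ^ w = Complex.exp (r * w) := by
    intro r w
    rw [Complex.cpow_def_of_ne_zero (by exact_mod_cast (Real.exp_pos r).ne'),
      ← Complex.ofReal_log (Real.exp_pos r).le, Real.log_exp]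
  have hc : (1 / Real.cosh (y / 2) : ℝ) = 2 * Real.exp (l - y / 2) := by
    have h1 : Real.exp l * (1 + Real.exp (-y)) = 1 := by
      rw [← hl, Real.sigmoid_def]
      exact inv_mul_cancel₀ (by positivity)
    rw [div_eq_iff (Real.cosh_pos _).ne', Real.cosh_eq, ← h1, mul_add, ← Real.exp_add]
    have : 2 * Real.exp (l - y / 2) * ((Real.exp (y / 2) + Real.exp (-(y / 2))) / 2)
      = Real.exp (l - y / 2) * Real.exp (y/2) + Real.exp (l - y/2) * Real.exp (-(y/2)) := by ring
    rw [this, ← Real.exp_add, ← Real.exp_add]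
    ring_nf
  rw [hbc, hb, hc, hl, hp, hp, abs_of_pos (by positivity), ← Real.exp_add, Complex.real_smul]
  push_cast
  rw [← mul_assoc, ← mul_assoc, ← mul_assoc, ← Complex.exp_add, ← Complex.exp_add]
  norm_num
  rw [← Complex.exp_add]
  congr 1
  ring

open MeasureTheory in
lemma sech_std (η : ℝ) :
    Integrable (fun y : ℝ => ((1 / Real.cosh (y / 2) : ℝ) : ℂ) * Complex.exp (Complex.I * η * y)) ∧
    ∫ y : ℝ, ((1 / Real.cosh (y / 2) : ℝ) : ℂ) * Complex.exp (Complex.I * η * y)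
      = 2 * (Real.pi / Real.cosh (Real.pi * η) : ℝ) := by
  set u : ℂ := 1 / 2 + Complex.I * η with hu
  set v : ℂ := 1 / 2 - Complex.I * η with hv
  have hur : 0 < u.re := by simp [hu]
  have hvr : 0 < v.re := by simp [hv]
  have hder : ∀ x ∈ (Set.univ : Set ℝ), HasDerivWithinAt Real.sigmoid
      (Real.sigmoid x * (1 - Real.sigmoid x)) Set.univ x :=
    fun x _ => (Real.hasDerivAt_sigmoid x).hasDerivWithinAt
  have hinj := Real.sigmoid_injective.injOn (s := Set.univ)
  have h1 := integrableOn_image_iff_integrableOn_abs_deriv_smul MeasurableSet.univ hder hinj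
    (fun x : ℝ => (x : ℂ) ^ (u - 1) * (1 - (x : ℂ)) ^ (v - 1))
  have h2 := integral_image_eq_integral_abs_deriv_smul MeasurableSet.univ hder hinj
    (fun x : ℝ => (x : ℂ) ^ (u - 1) * (1 - (x : ℂ)) ^ (v - 1))
  have hconv := Complex.betaIntegral_convergent hur hvr
  rw [intervalIntegrable_iff_integrableOn_Ioo_of_le zero_le_one] at hconv
  have hB : Complex.betaIntegral u v = Real.pi / Complex.cosh (Real.pi * η) := by
    have := Complex.Gamma_mul_Gamma_eq_betaIntegral hur hvr
    have huv : v = 1 - u := by rw [hu, hv]; ring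
    have huv' : u + v = 1 := by rw [huv]; ring
    rw [huv', Complex.Gamma_one, one_mul] at this
    rw [← this, huv, Complex.Gamma_mul_Gamma_one_sub]
    congr 1
    rw [hu, ← Complex.cos_mul_I, ← Complex.cos_sub_pi_div_two, ← Complex.cos_neg]
    rw [← Complex.cos_neg]
    congr 1
    ring
  rw [Set.image_univ, Real.range_sigmoid] at h1 h2
  simp only [hu, hv, sech_pointwise, integrableOn_univ, setIntegral_univ] at h1 h2
  constructor
  · have := (h1.1 hconv).const_mul 2
    refine this.congr (Filter.Eventually.of_forall fun y => ?_)
    simp only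
    ring
  · rw [integral_const_mul] at h2
    rw [Complex.betaIntegral, intervalIntegral.integral_of_le zero_le_one,
      integral_Ioc_eq_integral_Ioo] at hB
    push_cast
    rw [← hB, h2]
    push_cast
    ring

open MeasureTheory in
lemma sech_fourier (β ω : ℝ) (hβ : 0 < β) :
    Integrable (fun s : ℝ => ((1 / Real.cosh (2 * Real.pi * s / β) : ℝ) : ℂ) *
      Complex.exp (-Complex.I * ω * s)) ∧
    ∫ s : ℝ, ((1 / Real.cosh (2 * Real.pi * s / β) : ℝ) : ℂ) * Complex.exp (-Complex.I * ω * s)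
      = (β / 2 / Real.cosh (β * ω / 4) : ℝ) := by
  have hpi := Real.pi_pos
  obtain ⟨h1, h2⟩ := sech_std (-(ω * β / (4 * Real.pi)))
  have hR : 4 * Real.pi / β ≠ 0 := by positivity
  have key : ∀ s : ℝ, ((1 / Real.cosh ((4 * Real.pi / β) * s / 2) : ℝ) : ℂ) *
      Complex.exp (Complex.I * ((-(ω * β / (4 * Real.pi)) : ℝ) : ℂ) *
        (((4 * Real.pi / β) * s : ℝ) : ℂ)) =
      ((1 / Real.cosh (2 * Real.pi * s / β) : ℝ) : ℂ) * Complex.exp (-Complex.I * ω * s) := by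
    intro s
    have e1 : (4 * Real.pi / β) * s / 2 = 2 * Real.pi * s / β := by ring
    have e2 : (-(ω * β / (4 * Real.pi))) * ((4 * Real.pi / β) * s) = -(ω * s) := by
      field_simp
    rw [e1, mul_assoc Complex.I, ← Complex.ofReal_mul, e2]
    congr 2
    push_cast
    ring
  constructor
  · have := h1.comp_mul_left' hR
    simpa only [key] using this
  · have := Measure.integral_comp_mul_left (fun y : ℝ => ((1 / Real.cosh (y / 2) : ℝ) : ℂ) *
      Complex.exp (Complex.I * ((-(ω * β / (4 * Real.pi)) : ℝ) : ℂ) * y)) (4 * Real.pi / β)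
    simp only [key] at this
    rw [this, h2, abs_of_pos (by positivity), Complex.real_smul]
    have e : Real.pi * -(ω * β / (4 * Real.pi)) = -(β * ω / 4) := by field_simp
    rw [e, Real.cosh_neg]
    have := (Real.cosh_pos (β * ω / 4)).ne'
    norm_cast
    field_simp
    norm_num

open MeasureTheory in
lemma gauss_fourier (σ β ω : ℝ) (hσ : 0 < σ) :
    Integrable (fun t : ℝ => ((Real.sin (-(β * σ ^ 2) * t) * Real.exp (-2 * σ ^ 2 * t ^ 2) : ℝ) : ℂ)
      * Complex.exp (-Complex.I * ω * t)) ∧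
    ∫ t : ℝ, ((Real.sin (-(β * σ ^ 2) * t) * Real.exp (-2 * σ ^ 2 * t ^ 2) : ℝ) : ℂ)
      * Complex.exp (-Complex.I * ω * t)
      = Complex.I * ((Real.sqrt (Real.pi / (2 * σ ^ 2)) * Real.exp (-ω ^ 2 / (8 * σ ^ 2)) *
        Real.exp (-(β ^ 2 * σ ^ 2 / 8)) * Real.sinh (β * ω / 4) : ℝ) : ℂ) := by
  set b : ℂ := ((-2 * σ ^ 2 : ℝ) : ℂ) with hb
  have hbr : b.re < 0 := by rw [hb, Complex.ofReal_re]; nlinarith [pow_pos hσ 2]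
  set c1 : ℂ := Complex.I * (β * σ ^ 2 - ω) with hc1
  set c2 : ℂ := -Complex.I * (β * σ ^ 2 + ω) with hc2
  have hpt : ∀ t : ℝ, ((Real.sin (-(β * σ ^ 2) * t) * Real.exp (-2 * σ ^ 2 * t ^ 2) : ℝ) : ℂ)
      * Complex.exp (-Complex.I * ω * t) =
      (Complex.I / 2) * (Complex.exp (b * t ^ 2 + c1 * t + 0) - Complex.exp (b * t ^ 2 + c2 * t + 0)) := by
    intro t
    have e1 : Complex.exp (b * t ^ 2 + c1 * t + 0) = Complex.exp (b * t ^ 2) *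
      Complex.exp (-(-(β * σ ^ 2) * t) * Complex.I) * Complex.exp (-Complex.I * ω * t) := by
      rw [← Complex.exp_add, ← Complex.exp_add, hc1]; congr 1; ring
    have e2 : Complex.exp (b * t ^ 2 + c2 * t + 0) = Complex.exp (b * t ^ 2) *
      Complex.exp ((-(β * σ ^ 2) * t) * Complex.I) * Complex.exp (-Complex.I * ω * t) := by
      rw [← Complex.exp_add, ← Complex.exp_add, hc2]; congr 1; ring
    rw [e1, e2, hb]
    push_cast
    rw [Complex.sin]
    ring
  have hi1 := integrable_cexp_quadratic' hbr c1 0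
  have hi2 := integrable_cexp_quadratic' hbr c2 0
  simp only [hpt]
  refine ⟨(hi1.sub hi2).const_mul _, ?_⟩
  rw [integral_const_mul, integral_sub hi1 hi2, integral_cexp_quadratic hbr,
    integral_cexp_quadratic hbr]
  have hs : ((Real.pi : ℂ) / -b) ^ (1 / 2 : ℂ) = (Real.sqrt (Real.pi / (2 * σ ^ 2)) : ℝ) := by
    rw [Real.sqrt_eq_rpow, Complex.ofReal_cpow (by positivity), hb]
    push_cast
    norm_num
  have hσc : (σ : ℂ) ≠ 0 := by exact_mod_cast hσ.ne'
  have e1 : (0 : ℂ) - c1 ^ 2 / (4 * b) = -ω ^ 2 / (8 * σ ^ 2) + (-(β ^ 2 * σ ^ 2 / 8)) + β * ω / 4 := by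
    rw [hc1, hb, mul_pow, Complex.I_sq]; push_cast; field_simp; ring
  have e2 : (0 : ℂ) - c2 ^ 2 / (4 * b) = -ω ^ 2 / (8 * σ ^ 2) + (-(β ^ 2 * σ ^ 2 / 8)) + -(β * ω / 4) := by
    rw [hc2, hb, mul_pow, neg_sq, Complex.I_sq]; push_cast; field_simp; ring
  rw [hs, e1, e2]
  simp only [Complex.exp_add]
  push_cast
  rw [Complex.sinh]
  ring

/-- Fourier transform of the kernel
`b₁(t) = (σ/(πβ))·e^{β²σ²/8}·( sech(2π·/β) * ( sin(−βσ²·)·e^{−2σ²·²} ) )(t)`: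
`b̂₁(ω) = ∫ b₁(t)·e^{−iωt} dt = (i/(2√(2π)))·e^{−ω²/(8σ²)}·tanh(βω/4)`. -/
theorem b1_fourier (σ β : ℝ) (hσ : 0 < σ) (hβ : 0 < β) (b₁ : ℝ → ℝ)
    (hb₁ : ∀ t : ℝ, b₁ t
      = σ / (Real.pi * β) * Real.exp (β ^ 2 * σ ^ 2 / 8) *
        ∫ s : ℝ, (1 / Real.cosh (2 * Real.pi * s / β)) *
          (Real.sin (-(β * σ ^ 2) * (t - s)) * Real.exp (-2 * σ ^ 2 * (t - s) ^ 2)))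
    (ω : ℝ) :
    ∫ t : ℝ, (b₁ t : ℂ) * Complex.exp (-Complex.I * (ω : ℂ) * (t : ℂ))
      = Complex.I / (2 * (Real.sqrt (2 * Real.pi) : ℂ))
        * (Real.exp (-ω ^ 2 / (8 * σ ^ 2)) : ℂ) * (Real.tanh (β * ω / 4) : ℂ) := by
  obtain ⟨hF, hFi⟩ := sech_fourier β ω hβ
  obtain ⟨hG, hGi⟩ := gauss_fourier σ β ω hσ
  have hconv := MeasureTheory.integral_convolution (ContinuousLinearMap.mul ℝ ℂ) hF hG
  rw [ContinuousLinearMap.mul_apply', hFi, hGi] at hconv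
  have hpt : ∀ t : ℝ, (b₁ t : ℂ) * Complex.exp (-Complex.I * (ω : ℂ) * (t : ℂ)) =
      ((σ / (Real.pi * β) * Real.exp (β ^ 2 * σ ^ 2 / 8) : ℝ) : ℂ) *
      MeasureTheory.convolution (fun s : ℝ => ((1 / Real.cosh (2 * Real.pi * s / β) : ℝ) : ℂ) *
        Complex.exp (-Complex.I * ω * s))
        (fun t : ℝ => ((Real.sin (-(β * σ ^ 2) * t) * Real.exp (-2 * σ ^ 2 * t ^ 2) : ℝ) : ℂ)
        * Complex.exp (-Complex.I * ω * t)) (ContinuousLinearMap.mul ℝ ℂ)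
        MeasureTheory.volume t := by
    intro t
    rw [hb₁ t, Complex.ofReal_mul, mul_assoc, ← integral_complex_ofReal,
      ← MeasureTheory.integral_mul_const, MeasureTheory.convolution_def]
    congr 2
    funext s
    have : Complex.exp (-Complex.I * ω * t) = Complex.exp (-Complex.I * ω * s) *
        Complex.exp (-Complex.I * ω * ((t - s : ℝ) : ℂ)) := by
      rw [← Complex.exp_add]; congr 1; push_cast; ring
    rw [ContinuousLinearMap.mul_apply', this, Complex.ofReal_mul]
    ring
  simp only [hpt]
  rw [MeasureTheory.integral_const_mul, hconv]
  have hpi := Real.pi_pos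
  have hs : Real.sqrt (Real.pi / (2 * σ ^ 2)) = Real.pi / (Real.sqrt (2 * Real.pi) * σ) := by
    rw [Real.sqrt_eq_iff_mul_self_eq (by positivity) (by positivity)]
    have := Real.mul_self_sqrt (show 0 ≤ 2 * Real.pi by positivity)
    have h2 : Real.pi / (Real.sqrt (2 * Real.pi) * σ) * (Real.pi / (Real.sqrt (2 * Real.pi) * σ))
      = Real.pi ^ 2 / ((Real.sqrt (2 * Real.pi) * Real.sqrt (2 * Real.pi)) * σ ^ 2) := by
      field_simp
    rw [h2, this]
    field_simp
  have hreal : (σ / (Real.pi * β) * Real.exp (β ^ 2 * σ ^ 2 / 8)) *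
      ((β / 2 / Real.cosh (β * ω / 4)) *
      (Real.sqrt (Real.pi / (2 * σ ^ 2)) * Real.exp (-ω ^ 2 / (8 * σ ^ 2)) *
        Real.exp (-(β ^ 2 * σ ^ 2 / 8)) * Real.sinh (β * ω / 4))) =
      1 / (2 * Real.sqrt (2 * Real.pi)) * Real.exp (-ω ^ 2 / (8 * σ ^ 2)) *
        Real.tanh (β * ω / 4) := by
    have hc := (Real.cosh_pos (β * ω / 4)).ne'
    have hq : Real.sqrt (2 * Real.pi) ≠ 0 := by positivity
    rw [hs, Real.tanh_eq_sinh_div_cosh, Real.exp_neg (β ^ 2 * σ ^ 2 / 8)]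
    have he := (Real.exp_pos (β ^ 2 * σ ^ 2 / 8)).ne'
    generalize Real.exp (β ^ 2 * σ ^ 2 / 8) = E at *
    generalize Real.exp (-ω ^ 2 / (8 * σ ^ 2)) = E2 at *
    generalize Real.sqrt (2 * Real.pi) = q at *
    field_simp
  have hC := congrArg (fun x : ℝ => Complex.I * (x : ℂ)) hreal
  simp only [Complex.ofReal_mul, Complex.ofReal_div] at hC ⊢
  push_cast at hC ⊢
  linear_combination hC
end
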